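/- Let λ = 9 and μ = 10 (so ρ = 9/10). Then ETT(9, 8) < ETT(8, 9), where ETT(a, b) = (a+2)/μ + (1/μ)·∫₀^∞ f_{a+1}(t)·EL_b(t) dt with f_{a+1}(t) = μ^{a+1} t^a e^{−μ t}/a! and EL_b given by the explicit integral formula. That is, even though the shorter queue has 8 customers (less than the steady-state mean 9) and the longer queue has 9 customers, joining the longer queue first yields a strictly smaller expected total time. -/

import Mathlib

open Real MeasureTheory Set Filter

/-- γ(y) = 1 + ρ − 2√ρ·cos(y). -/
noncomputable def gam (ρ y : ℝ) : ℝ := 1 + ρ - 2 * Real.sqrt ρ * Real.cos y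

/-- a_k(y) = sin(k·y) − √ρ·sin((k+1)·y). -/
noncomputable def aco (ρ : ℝ) (k : ℕ) (y : ℝ) : ℝ :=
  Real.sin ((k : ℝ) * y) - Real.sqrt ρ * Real.sin (((k : ℝ) + 1) * y)

/-- Transient expected queue length of an M/M/1 queue started with `i` customers. -/
noncomputable def EL (lam mu : ℝ) (i : ℕ) (t : ℝ) : ℝ :=
  (2 / Real.pi) * (lam / mu) ^ ((1 - (i : ℝ)) / 2) *
    (∫ y in (0 : ℝ)..Real.pi,
      Real.exp (-(mu * t * gam (lam / mu) y)) / (gam (lam / mu) y) ^ 2 *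
        (aco (lam / mu) i y * Real.sin y)) +
  (lam / mu) / (1 - lam / mu)

/-- Transient probability that an M/M/1 queue started with `i` customers has `j` at time `t`. -/
noncomputable def pq (lam mu : ℝ) (i j : ℕ) (t : ℝ) : ℝ :=
  (2 / Real.pi) * (lam / mu) ^ (((j : ℝ) - (i : ℝ)) / 2) *
    (∫ y in (0 : ℝ)..Real.pi,
      Real.exp (-(mu * t * gam (lam / mu) y)) / gam (lam / mu) y *
        (aco (lam / mu) i y * aco (lam / mu) j y)) +
  (1 - lam / mu) * (lam / mu) ^ j

/-- Erlang(n) density with rate `mu`: f_n(t) = μⁿ t^{n−1} e^{−μt}/(n−1)!. -/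
noncomputable def erl (mu : ℝ) (n : ℕ) (t : ℝ) : ℝ :=
  mu ^ n * t ^ (n - 1) * Real.exp (-(mu * t)) / (Nat.factorial (n - 1) : ℝ)

/-- Expected total time to complete queue with `a` customers first, then queue with `b`. -/
noncomputable def ETT (lam mu : ℝ) (a b : ℕ) : ℝ :=
  ((a : ℝ) + 2) / mu + (1 / mu) * ∫ t in Set.Ioi (0 : ℝ), erl mu (a + 1) t * EL lam mu b t



/-- generic denominators -/
noncomputable def dd (s β y : ℝ) : ℝ := β - 2 * s * Real.cos y

noncomputable def CC (s β : ℝ) (k m : ℕ) : ℝ :=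
  (2 / Real.pi) * ∫ y in (0 : ℝ)..Real.pi, Real.cos (m * y) * ((dd s β y) ^ k)⁻¹

noncomputable def SS (s β : ℝ) (k m : ℕ) : ℝ :=
  (2 / Real.pi) * ∫ y in (0 : ℝ)..Real.pi, Real.sin y * Real.sin (m * y) * ((dd s β y) ^ k)⁻¹

lemma dd_pos {s β : ℝ} (hs : 0 < s) (hb : 2 * s < β) (y : ℝ) : 0 < dd s β y := by
  unfold dd
  nlinarith [Real.cos_le_one y]

lemma dd_cont (s β : ℝ) : Continuous (dd s β) := by unfold dd; fun_prop

lemma inv_cont {s β : ℝ} (hs : 0 < s) (hb : 2 * s < β) (k : ℕ) :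
    Continuous (fun y => ((dd s β y) ^ k)⁻¹) :=
  ((dd_cont s β).pow k).inv₀ fun y => (pow_pos (dd_pos hs hb y) k).ne'

lemma CC_ii {s β : ℝ} (hs : 0 < s) (hb : 2 * s < β) (k m : ℕ) :
    IntervalIntegrable (fun y => Real.cos (m * y) * ((dd s β y) ^ k)⁻¹) volume 0 Real.pi := by
  have := inv_cont hs hb k
  apply Continuous.intervalIntegrable
  fun_prop

lemma SS_ii {s β : ℝ} (hs : 0 < s) (hb : 2 * s < β) (k m : ℕ) :
    IntervalIntegrable (fun y => Real.sin y * Real.sin (m * y) * ((dd s β y) ^ k)⁻¹)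
      volume 0 Real.pi := by
  have := inv_cont hs hb k
  apply Continuous.intervalIntegrable
  fun_prop

lemma L1 {s β : ℝ} (hs : 0 < s) (hb : 2 * s < β) (k m : ℕ) :
    β * CC s β (k+1) (m+1) - s * (CC s β (k+1) m + CC s β (k+1) (m+2)) = CC s β k (m+1) := by
  unfold CC
  have h : ∀ y : ℝ, Real.cos (((m+1 : ℕ):ℝ) * y) * ((dd s β y) ^ k)⁻¹
      = β * (Real.cos (((m+1 : ℕ):ℝ) * y) * ((dd s β y) ^ (k+1))⁻¹)
       - s * (Real.cos ((m:ℝ) * y) * ((dd s β y) ^ (k+1))⁻¹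
        + Real.cos (((m+2 : ℕ):ℝ) * y) * ((dd s β y) ^ (k+1))⁻¹) := by
    intro y
    have h0 := dd_pos hs hb y
    have e1 : Real.cos ((m:ℝ) * y) + Real.cos (((m+2 : ℕ):ℝ) * y)
        = 2 * Real.cos y * Real.cos (((m+1 : ℕ):ℝ) * y) := by
      have a1 : (m:ℝ) * y = ((m+1 : ℕ):ℝ) * y - y := by push_cast; ring
      have a2 : ((m+2 : ℕ):ℝ) * y = ((m+1 : ℕ):ℝ) * y + y := by push_cast; ring
      rw [a1, a2, Real.cos_sub, Real.cos_add]; ring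
    rw [← add_mul, e1]
    have e2 : ((dd s β y) ^ k)⁻¹ = dd s β y * ((dd s β y) ^ (k+1))⁻¹ := by
      rw [pow_succ]
      field_simp
    rw [e2]
    have e3 : dd s β y = β - 2 * s * Real.cos y := rfl
    nth_rewrite 1 [e3]
    ring
  simp_rw [h]
  rw [intervalIntegral.integral_sub, intervalIntegral.integral_const_mul,
    intervalIntegral.integral_const_mul, intervalIntegral.integral_add]
  · ring
  · exact CC_ii hs hb _ _
  · exact CC_ii hs hb _ _
  · exact (CC_ii hs hb _ _).const_mul _
  · exact ((CC_ii hs hb _ _).add (CC_ii hs hb _ _)).const_mul _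

lemma L10 {s β : ℝ} (hs : 0 < s) (hb : 2 * s < β) (k : ℕ) :
    β * CC s β (k+1) 0 - 2 * s * CC s β (k+1) 1 = CC s β k 0 := by
  unfold CC
  have h : ∀ y : ℝ, Real.cos (((0 : ℕ):ℝ) * y) * ((dd s β y) ^ k)⁻¹
      = β * (Real.cos (((0 : ℕ):ℝ) * y) * ((dd s β y) ^ (k+1))⁻¹)
       - 2 * s * (Real.cos (((1:ℕ):ℝ) * y) * ((dd s β y) ^ (k+1))⁻¹) := by
    intro y
    have h0 := dd_pos hs hb y
    have e2 : ((dd s β y) ^ k)⁻¹ = dd s β y * ((dd s β y) ^ (k+1))⁻¹ := by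
      rw [pow_succ]
      field_simp
    rw [e2]
    have e3 : dd s β y = β - 2 * s * Real.cos y := rfl
    nth_rewrite 1 [e3]
    simp
    ring
  simp_rw [h]
  rw [intervalIntegral.integral_sub, intervalIntegral.integral_const_mul,
    intervalIntegral.integral_const_mul]
  · ring
  · exact (CC_ii hs hb _ _).const_mul _
  · exact (CC_ii hs hb _ _).const_mul _

lemma C00 (s β : ℝ) : CC s β 0 0 = 2 := by
  unfold CC
  have := Real.pi_pos
  simp

lemma C0m (s β : ℝ) (m : ℕ) : CC s β 0 (m+1) = 0 := by
  unfold CC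
  have h : ((m+1:ℕ):ℝ) ≠ 0 := by positivity
  simp only [pow_zero, inv_one, mul_one]
  rw [intervalIntegral.integral_comp_mul_left (fun x => Real.cos x) h]
  simp only [integral_cos, mul_zero, Real.sin_zero, sub_zero, Real.sin_nat_mul_pi, smul_zero]

lemma SSC {s β : ℝ} (hs : 0 < s) (hb : 2 * s < β) (k m : ℕ) :
    2 * SS s β k (m+1) = CC s β k m - CC s β k (m+2) := by
  unfold CC SS
  have h : ∀ y : ℝ, Real.sin y * Real.sin (((m+1 : ℕ):ℝ) * y) * ((dd s β y) ^ k)⁻¹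
      = (1/2) * (Real.cos ((m:ℝ) * y) * ((dd s β y) ^ k)⁻¹
        - Real.cos (((m+2 : ℕ):ℝ) * y) * ((dd s β y) ^ k)⁻¹) := by
    intro y
    have e1 : Real.cos ((m:ℝ) * y) - Real.cos (((m+2 : ℕ):ℝ) * y)
        = 2 * Real.sin y * Real.sin (((m+1 : ℕ):ℝ) * y) := by
      have a1 : (m:ℝ) * y = ((m+1 : ℕ):ℝ) * y - y := by push_cast; ring
      have a2 : ((m+2 : ℕ):ℝ) * y = ((m+1 : ℕ):ℝ) * y + y := by push_cast; ring
      rw [a1, a2, Real.cos_sub, Real.cos_add]; ring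
    rw [← sub_mul, e1]
    ring
  simp_rw [h]
  rw [intervalIntegral.integral_const_mul, intervalIntegral.integral_sub]
  · ring
  · exact CC_ii hs hb _ _
  · exact CC_ii hs hb _ _

lemma IBP {s β : ℝ} (hs : 0 < s) (hb : 2 * s < β) (k m : ℕ) :
    2 * s * (k+1) * SS s β (k+2) m = m * CC s β (k+1) m := by
  have hd : ∀ y ∈ Set.uIcc (0:ℝ) Real.pi, HasDerivAt
      (fun y => Real.sin (m * y) * ((dd s β y) ^ (k+1))⁻¹)
      (m * (Real.cos (m * y) * ((dd s β y) ^ (k+1))⁻¹) -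
       2 * s * (k+1) * (Real.sin y * Real.sin (m * y) * ((dd s β y) ^ (k+2))⁻¹)) y := by
    intro y _
    have h0 := dd_pos hs hb y
    have h1 : HasDerivAt (dd s β) (2 * s * Real.sin y) y := by
      unfold dd
      have := ((Real.hasDerivAt_cos y).const_mul (2*s)).const_sub β
      simpa using this
    have h2 : HasDerivAt (fun y => Real.sin ((m:ℝ) * y)) (Real.cos (m*y) * m) y := by
      have := ((hasDerivAt_id y).const_mul (m:ℝ)).sin
      simpa using this
    have h3 := h2.mul ((h1.pow (k+1)).inv (pow_pos h0 _).ne')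
    refine h3.congr_deriv ?_
    simp only [Pi.pow_apply, Pi.inv_apply, Nat.add_sub_cancel]
    push_cast
    rw [pow_succ _ (k+1), pow_succ _ k]
    field_simp
    ring
  have h4 := intervalIntegral.integral_eq_sub_of_hasDerivAt hd
    (((CC_ii hs hb _ _).const_mul _).sub ((SS_ii hs hb _ _).const_mul _))
  rw [intervalIntegral.integral_sub ((CC_ii hs hb _ _).const_mul _) ((SS_ii hs hb _ _).const_mul _),
    intervalIntegral.integral_const_mul, intervalIntegral.integral_const_mul] at h4
  simp only [Real.sin_nat_mul_pi, mul_zero, Real.sin_zero, zero_mul, sub_zero] at h4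
  unfold SS CC
  linear_combination (-(2/Real.pi)) * h4

lemma step {s β : ℝ} (hs : 0 < s) (hb : 2 * s < β) (k m : ℕ) :
    CC s β (k+2) m * (β^2 - 4*s^2) * (k+1) =
      β * (k+1+m) * CC s β (k+1) m + 2 * s * (k - m) * CC s β (k+1) (m+1) := by
  have B := L1 hs hb (k+1) m
  have B2 := SSC hs hb (k+2) m
  have B3 := IBP hs hb k (m+1)
  push_cast at B3
  have eA : (k+1) * (β * CC s β (k+2) m - 2 * s * CC s β (k+2) (m+1)) = (k+1+m) * CC s β (k+1) m := by
    rcases m with _ | m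
    · have := L10 hs hb (k+1)
      simp only [Nat.cast_zero, add_zero, zero_add] at this ⊢
      linear_combination (k+1:ℝ) * this
    · have A := L1 hs hb (k+1) m
      have A2 := SSC hs hb (k+2) m
      have A3 := IBP hs hb k (m+1)
      push_cast at A3 ⊢
      simp only [add_assoc, Nat.reduceAdd] at *
      linear_combination (k+1:ℝ) * A - s * (k+1) * A2 + A3
  have eB : (k+1) * (β * CC s β (k+2) (m+1) - 2 * s * CC s β (k+2) m) = (k-m) * CC s β (k+1) (m+1) := by
    simp only [add_assoc, Nat.reduceAdd] at *
    linear_combination (k+1:ℝ) * B + s * (k+1) * B2 - B3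
  linear_combination β * eA + 2 * s * eB

lemma CC_bdd {s β : ℝ} (hs : 0 < s) (hb : 2 * s < β) (m : ℕ) :
    |CC s β 1 m| ≤ 2 * (β - 2*s)⁻¹ := by
  unfold CC
  have h1 := intervalIntegral.norm_integral_le_of_norm_le_const (a := 0) (b := Real.pi)
    (f := fun y => Real.cos (m * y) * ((dd s β y) ^ 1)⁻¹) (C := (β - 2*s)⁻¹) (by
      intro y _
      have h0 := dd_pos hs hb y
      rw [pow_one, norm_mul, Real.norm_eq_abs, Real.norm_eq_abs, abs_of_pos (inv_pos.2 h0)]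
      have : (dd s β y)⁻¹ ≤ (β - 2*s)⁻¹ := by
        apply inv_anti₀ (by linarith)
        unfold dd
        nlinarith [Real.cos_le_one y]
      calc _ ≤ 1 * (dd s β y)⁻¹ := by gcongr; exact Real.abs_cos_le_one _
        _ ≤ _ := by linarith)
  rw [abs_mul, abs_of_pos (by positivity)]
  rw [Real.norm_eq_abs, sub_zero, abs_of_pos Real.pi_pos] at h1
  calc _ ≤ 2 / Real.pi * ((β - 2*s)⁻¹ * Real.pi) := by gcongr
    _ = _ := by field_simp

lemma geo {s β u : ℝ} (hs : 0 < s) (hb : 2 * s < β) (hu : 0 < u) (hu1 : u < 1)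
    (hq : s * u^2 - β * u + s = 0) (m : ℕ) : CC s β 1 m = CC s β 1 0 * u ^ m := by
  have hd : ∀ m, CC s β 1 (m+1) - u * CC s β 1 m = (CC s β 1 1 - u * CC s β 1 0) * (u⁻¹)^m := by
    intro m
    induction m with
    | zero => simp
    | succ m ih =>
      have h := L1 hs hb 0 m
      rw [C0m] at h
      simp only [zero_add] at h
      rw [pow_succ, ← mul_assoc, ← ih, ← div_eq_mul_inv, eq_div_iff hu.ne']
      have : s * ((CC s β 1 (m+2) - u * CC s β 1 (m+1)) * u - (CC s β 1 (m+1) - u * CC s β 1 m)) = 0 := by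
        linear_combination -u * h - CC s β 1 (m+1) * hq
      rcases mul_eq_zero.1 this with h | h
      · exact absurd h hs.ne'
      · linear_combination h
  have hz : CC s β 1 1 - u * CC s β 1 0 = 0 := by
    by_contra hne
    have ht := (tendsto_pow_atTop_atTop_of_one_lt ((one_lt_inv₀ hu).2 hu1)).const_mul_atTop
      (abs_pos.2 hne)
    obtain ⟨m, hm⟩ := (ht.eventually_gt_atTop (2 * (β - 2*s)⁻¹ + u * (2 * (β - 2*s)⁻¹))).exists
    have h1 := congrArg abs (hd m)
    rw [abs_mul, abs_of_pos (pow_pos (inv_pos.2 hu) m)] at h1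
    have h2 := abs_sub (CC s β 1 (m+1)) (u * CC s β 1 m)
    rw [abs_mul u, abs_of_pos hu] at h2
    have h3 := CC_bdd hs hb (m+1)
    have h4 := mul_le_mul_of_nonneg_left (CC_bdd hs hb m) hu.le
    linarith
  induction m with
  | zero => simp
  | succ m ih =>
    have := hd m
    rw [hz, zero_mul] at this
    rw [pow_succ]
    linear_combination this + u * ih

lemma C10 {s β u : ℝ} (hs : 0 < s) (hb : 2 * s < β) (hu : 0 < u) (hu1 : u < 1)
    (hq : s * u^2 - β * u + s = 0) : CC s β 1 0 * (β - 2 * s * u) = 2 := by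
  have h := L10 hs hb 0
  rw [zero_add, C00, geo hs hb hu hu1 hq 1] at h
  linear_combination h

lemma pf (g : ℝ) (hg : 0 < g) (n : ℕ) :
    (g^2)⁻¹ * ((1+g)^n)⁻¹ = (g^2)⁻¹ - n * (g^1)⁻¹
      + ∑ k ∈ Finset.range n, ((n:ℝ) - k) * ((1+g)^(k+1))⁻¹ := by
  induction n with
  | zero => simp
  | succ n ih =>
    have h1 : (0:ℝ) < 1 + g := by linarith
    have e : (g^2)⁻¹ * ((1+g)^(n+1))⁻¹ = ((g^2)⁻¹ * ((1+g)^n)⁻¹) * (1+g)⁻¹ := by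
      rw [pow_succ (1+g), mul_inv]; ring
    rw [e, ih, Finset.sum_range_succ', add_mul, Finset.sum_mul]
    have e2 : ∀ k ∈ Finset.range n, ((n:ℝ) - k) * ((1+g)^(k+1))⁻¹ * (1+g)⁻¹
        = (((n+1:ℕ):ℝ) - ((k+1:ℕ):ℝ)) * ((1+g)^(k+1+1))⁻¹ := by
      intro k _
      rw [pow_succ (1+g) (k+1), mul_inv]; push_cast; ring
    rw [Finset.sum_congr rfl e2]
    push_cast
    have e3 : ((g^2)⁻¹ - n * (g^1)⁻¹) * (1+g)⁻¹ =
      (g^2)⁻¹ - (n+1) * (g^1)⁻¹ + (n+1-0) * ((1+g)^(0+1))⁻¹ := by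
      field_simp
      ring
    rw [e3]; ring

lemma pow_exp_integrable {c : ℝ} (hc : 0 < c) (a : ℕ) :
    IntegrableOn (fun t : ℝ => t ^ a * Real.exp (-(c * t))) (Ioi 0) := by
  have h := integrableOn_rpow_mul_exp_neg_mul_rpow (p := 1) (s := a) (b := c)
    (by have : (0:ℝ) ≤ a := by positivity
        linarith) one_pos hc
  simpa [Real.rpow_natCast] using h

lemma pow_exp_integral {c : ℝ} (hc : 0 < c) (a : ℕ) :
    ∫ t in Ioi (0:ℝ), t ^ a * Real.exp (-(c * t)) = (c^(a+1))⁻¹ * (Nat.factorial a : ℝ) := by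
  have h := Real.integral_rpow_mul_exp_neg_mul_Ioi (a := a + 1) (r := c) (by positivity) hc
  rw [Real.Gamma_nat_eq_factorial] at h
  simp only [add_sub_cancel_right, Real.rpow_natCast] at h
  rw [h]
  have : ((a:ℝ) + 1) = ((a+1 : ℕ) : ℝ) := by push_cast; ring
  rw [this, Real.rpow_natCast, one_div, inv_pow]

lemma erl_integrable (a : ℕ) : IntegrableOn (erl 10 (a+1)) (Ioi 0) := by
  have h := (pow_exp_integrable (c := 10) (by norm_num) a).const_mul
    (10^(a+1) / (Nat.factorial a : ℝ))
  refine h.congr (Eventually.of_forall fun t => ?_)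
  simp only [erl, Nat.add_sub_cancel]
  ring

lemma erl_laplace (a : ℕ) {g : ℝ} (hg : 0 < 1 + g) :
    ∫ t in Ioi (0:ℝ), erl 10 (a+1) t * Real.exp (-(10 * t * g)) = ((1+g)^(a+1))⁻¹ := by
  have e : ∀ t : ℝ, erl 10 (a+1) t * Real.exp (-(10 * t * g)) =
      (10^(a+1) / (Nat.factorial a : ℝ)) * (t ^ a * Real.exp (-((10*(1+g)) * t))) := by
    intro t
    have : Real.exp (-((10*(1+g)) * t)) = Real.exp (-(10*t)) * Real.exp (-(10 * t * g)) := by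
      rw [← Real.exp_add]; congr 1; ring
    rw [this]
    simp only [erl, Nat.add_sub_cancel]
    ring
  simp_rw [e]
  rw [integral_const_mul, pow_exp_integral (by positivity)]
  have : (Nat.factorial a : ℝ) ≠ 0 := by positivity
  rw [mul_pow]
  field_simp

lemma gam_eq (y : ℝ) : gam (9/10) y = dd (√(9/10)) (19/10) y := by
  unfold gam dd; ring

lemma s_sq : (√(9/10:ℝ))^2 = 9/10 := Real.sq_sqrt (by norm_num)
lemma s_pos : 0 < √(9/10:ℝ) := by positivity
lemma s_lt : 2 * √(9/10:ℝ) < 19/10 := by nlinarith [s_sq, s_pos]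

lemma fub (a b : ℕ) : ∫ t in Ioi (0:ℝ), erl 10 (a+1) t * EL 9 10 b t =
    9 + (2 / Real.pi) * (9/10:ℝ) ^ ((1 - (b:ℝ))/2) *
      ∫ y in (0:ℝ)..Real.pi, (aco (9/10) b y * Real.sin y) *
        (((gam (9/10) y)^2)⁻¹ * ((1 + gam (9/10) y)^(a+1))⁻¹) := by
  have gpos : ∀ y, 0 < gam (9/10) y := fun y => by
    rw [gam_eq]; exact dd_pos s_pos s_lt y
  have gc : Continuous (gam (9/10)) := by unfold gam; fun_prop
  set h : ℝ → ℝ := fun y => (aco (9/10) b y * Real.sin y) * ((gam (9/10) y)^2)⁻¹ with hh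
  have hc : Continuous h := by
    have h1 : Continuous (fun y => ((gam (9/10) y)^2)⁻¹) :=
      (gc.pow 2).inv₀ fun y => (pow_pos (gpos y) 2).ne'
    have h2 : Continuous (aco (9/10) b) := by unfold aco; fun_prop
    exact (h2.mul Real.continuous_sin).mul h1
  set F : ℝ → ℝ → ℝ := fun y t => erl 10 (a+1) t * Real.exp (-(10 * t * gam (9/10) y)) * h y with hF
  have ec : Continuous (erl 10 (a+1)) := by unfold erl; fun_prop
  have hint : Integrable (Function.uncurry F)
      ((volume.restrict (Set.uIoc 0 Real.pi)).prod (volume.restrict (Ioi (0:ℝ)))) := by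
    have hi1 : Integrable h (volume.restrict (Set.uIoc 0 Real.pi)) :=
      (intervalIntegrable_iff.1 (hc.intervalIntegrable 0 Real.pi))
    have hi := (hi1.mul_prod (erl_integrable a)).norm
    refine hi.mono' ?_ ?_
    · apply Continuous.aestronglyMeasurable
      simp only [hF, Function.uncurry_def]
      fun_prop
    · rw [Measure.prod_restrict]
      refine (ae_restrict_iff' (measurableSet_uIoc.prod measurableSet_Ioi)).2
        (Eventually.of_forall ?_)
      rintro ⟨y, t⟩ ⟨_, ht⟩
      simp only [Set.mem_Ioi] at ht
      simp only [hF, Function.uncurry_apply_pair, norm_mul]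
      have : ‖Real.exp (-(10 * t * gam (9/10) y))‖ ≤ 1 := by
        rw [Real.norm_eq_abs, abs_of_pos (Real.exp_pos _)]
        apply Real.exp_le_one_iff.2
        have := gpos y
        have : 0 ≤ 10 * t * gam (9/10) y := by positivity
        linarith
      calc _ ≤ ‖erl 10 (a+1) t‖ * 1 * ‖h y‖ := by gcongr
        _ = _ := by ring
  have hsw := intervalIntegral_integral_swap hint
  have hel : ∀ t, erl 10 (a+1) t * EL 9 10 b t =
      (2 / Real.pi) * (9/10:ℝ) ^ ((1 - (b:ℝ))/2) * (∫ y in (0:ℝ)..Real.pi, F y t)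
       + 9 * (erl 10 (a+1) t * Real.exp (-(10 * t * 0))) := by
    intro t
    have : (∫ y in (0:ℝ)..Real.pi, F y t) = erl 10 (a+1) t * ∫ y in (0 : ℝ)..Real.pi,
      Real.exp (-(10 * t * gam (9 / 10) y)) / (gam (9 / 10) y) ^ 2 *
        (aco (9 / 10) b y * Real.sin y) := by
      rw [← intervalIntegral.integral_const_mul]
      congr 1
      ext y
      simp only [hF, hh]
      ring
    rw [this]
    unfold EL
    simp only [mul_zero, neg_zero, Real.exp_zero]
    ring
  simp_rw [hel]
  have hI2 : Integrable (fun t => ∫ y in (0:ℝ)..Real.pi, F y t) (volume.restrict (Ioi (0:ℝ))) := by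
    have := hint.integral_prod_right
    refine this.congr (Eventually.of_forall fun t => ?_)
    simp only [Function.uncurry_apply_pair]
    rw [intervalIntegral.integral_of_le Real.pi_pos.le, Set.uIoc_of_le Real.pi_pos.le]
  rw [integral_add (hI2.const_mul _) (by
    simpa using (erl_integrable a).const_mul 9), integral_const_mul, integral_const_mul,
    erl_laplace a (by norm_num), ← hsw]
  have e5 : (∫ y in (0:ℝ)..Real.pi, ∫ t in Ioi (0:ℝ), F y t) =
    ∫ y in (0:ℝ)..Real.pi, (aco (9/10) b y * Real.sin y) *
        (((gam (9/10) y)^2)⁻¹ * ((1 + gam (9/10) y)^(a+1))⁻¹) := by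
    congr 1
    ext y
    simp only [hF]
    rw [integral_mul_const, erl_laplace a (by linarith [gpos y])]
    simp only [hh]; ring
  rw [e5]
  simp
  ring

noncomputable def TT (s β : ℝ) (k b : ℕ) : ℝ := SS s β k b - s * SS s β k (b+1)

lemma TT_int {s β : ℝ} (hs : 0 < s) (hb : 2 * s < β) (k b : ℕ) :
    TT s β k b = (2/Real.pi) * ∫ y in (0:ℝ)..Real.pi,
      (Real.sin y * Real.sin (b * y) * ((dd s β y) ^ k)⁻¹
       - s * (Real.sin y * Real.sin ((b+1:ℕ) * y) * ((dd s β y) ^ k)⁻¹)) := by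
  rw [intervalIntegral.integral_sub (SS_ii hs hb _ _) ((SS_ii hs hb _ _).const_mul _),
    intervalIntegral.integral_const_mul]
  unfold TT SS
  ring

lemma TT_ii {s β : ℝ} (hs : 0 < s) (hb : 2 * s < β) (k b : ℕ) :
    IntervalIntegrable (fun y =>
      (Real.sin y * Real.sin (b * y) * ((dd s β y) ^ k)⁻¹
       - s * (Real.sin y * Real.sin ((b+1:ℕ) * y) * ((dd s β y) ^ k)⁻¹))) volume 0 Real.pi :=
  (SS_ii hs hb _ _).sub ((SS_ii hs hb _ _).const_mul _)

lemma JT (n b : ℕ) : (2 / Real.pi) *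
      (∫ y in (0:ℝ)..Real.pi, (aco (9/10) b y * Real.sin y) *
        (((gam (9/10) y)^2)⁻¹ * ((1 + gam (9/10) y)^n)⁻¹)) =
    TT √(9/10) (19/10) 2 b - n * TT √(9/10) (19/10) 1 b
     + ∑ k ∈ Finset.range n, ((n:ℝ) - k) * TT √(9/10) (29/10) (k+1) b := by
  have hb2 : 2 * √(9/10:ℝ) < 29/10 := by linarith [s_lt]
  simp only [TT_int s_pos s_lt, TT_int s_pos hb2]
  have e : ∀ y, (aco (9/10) b y * Real.sin y) *
        (((gam (9/10) y)^2)⁻¹ * ((1 + gam (9/10) y)^n)⁻¹) =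
     (Real.sin y * Real.sin (b * y) * ((dd √(9/10) (19/10) y) ^ 2)⁻¹
       - √(9/10) * (Real.sin y * Real.sin ((b+1:ℕ) * y) * ((dd √(9/10) (19/10) y) ^ 2)⁻¹))
     - n * (Real.sin y * Real.sin (b * y) * ((dd √(9/10) (19/10) y) ^ 1)⁻¹
       - √(9/10) * (Real.sin y * Real.sin ((b+1:ℕ) * y) * ((dd √(9/10) (19/10) y) ^ 1)⁻¹))
     + ∑ k ∈ Finset.range n, ((n:ℝ) - k) *
       (Real.sin y * Real.sin (b * y) * ((dd √(9/10) (29/10) y) ^ (k+1))⁻¹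
       - √(9/10) * (Real.sin y * Real.sin ((b+1:ℕ) * y) * ((dd √(9/10) (29/10) y) ^ (k+1))⁻¹)) := by
    intro y
    have h1 : 0 < gam (9/10) y := by rw [gam_eq]; exact dd_pos s_pos s_lt y
    rw [pf _ h1]
    have h2 : dd √(9/10) (29/10) y = 1 + gam (9/10) y := by unfold dd gam; ring
    rw [h2, ← gam_eq, mul_add, Finset.mul_sum]
    unfold aco
    push_cast
    congr 1
    · ring
    · apply Finset.sum_congr rfl
      intro k _
      ring
  simp_rw [e]
  rw [intervalIntegral.integral_add, intervalIntegral.integral_sub,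
    intervalIntegral.integral_const_mul, intervalIntegral.integral_finsetSum, mul_add,
    Finset.mul_sum]
  · congr 1
    · ring
    · apply Finset.sum_congr rfl
      intro k _
      rw [intervalIntegral.integral_const_mul]
      ring
  · intro k _
    exact (TT_ii s_pos hb2 _ _).const_mul _
  · exact TT_ii s_pos s_lt _ _
  · exact (TT_ii s_pos s_lt _ _).const_mul _
  · exact (TT_ii s_pos s_lt _ _).sub ((TT_ii s_pos s_lt _ _).const_mul _)
  · rw [← Finset.sum_fn]
    apply IntervalIntegrable.sum
    intro k _
    exact (TT_ii s_pos hb2 _ _).const_mul _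

lemma pref (b : ℕ) : (9/10:ℝ) ^ ((1 - ((b+1:ℕ):ℝ))/2) * √(9/10) ^ b = 1 := by
  rw [Real.sqrt_eq_rpow, ← Real.rpow_natCast, ← Real.rpow_mul (by norm_num),
    ← Real.rpow_add (by norm_num)]
  have : ((1 - ((b+1:ℕ):ℝ))/2) + 1/2 * (b:ℝ) = 0 := by push_cast; ring
  rw [this, Real.rpow_zero]

lemma geo19 (m : ℕ) : CC √(9/10) (19/10) 1 m = 20 * √(9/10) ^ m := by
  have hq : √(9/10:ℝ) * √(9/10)^2 - 19/10 * √(9/10) + √(9/10) = 0 := by rw [s_sq]; ring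
  have h1 : √(9/10:ℝ) < 1 := by linarith [s_lt]
  have h := C10 s_pos s_lt s_pos h1 hq
  have : CC √(9/10) (19/10) 1 0 = 20 := by
    linear_combination 10 * h + 20 * CC √(9/10) (19/10) 1 0 * s_sq
  rw [geo s_pos s_lt s_pos h1 hq, this]

lemma T191 (b : ℕ) : TT √(9/10) (19/10) 1 (b+1) = √(9/10)^b * (1/10) := by
  have h1 := SSC s_pos s_lt 1 b
  have h2 := SSC s_pos s_lt 1 (b+1)
  simp only [geo19] at h1 h2
  unfold TT
  have hs := s_sq
  set s := √(9/10:ℝ)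
  have e3 : s^3 = 9/10 * s := by rw [← hs]; ring
  have e4 : s^4 = (9/10)^2 := by rw [← hs]; ring
  simp only [pow_add] at h1 h2
  linear_combination (1/2) * h1 - (s/2) * h2 + s^b * (-10 * hs - 10 * hs + 10 * e4)

lemma T192 (b : ℕ) : TT √(9/10) (19/10) 2 (b+1) = √(9/10)^b * (b - 8) := by
  have h1 := IBP s_pos s_lt 0 (b+1)
  have h2 := IBP s_pos s_lt 0 (b+2)
  simp only [zero_add, geo19] at h1 h2
  unfold TT
  have hs := s_sq
  have hp := s_pos
  set s := √(9/10:ℝ)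
  push_cast at h1 h2
  simp only [pow_add] at h1 h2
  have h3 : (2 * s) * (SS s (19/10) 2 (b+1) - s * SS s (19/10) 2 (b+1+1)
      - s^b * (b - 8)) = 0 := by
    simp only [add_assoc, Nat.reduceAdd]
    linear_combination h1 - s * h2 - 20 * (b+2) * s^b * s * hs
  rcases mul_eq_zero.1 h3 with h | h
  · linarith
  · linarith

/-- multiplication by `r` of `p + q r`, where `9 r² = 29 r - 10`. -/
def mulr (x : ℚ × ℚ) : ℚ × ℚ := (-(10/9) * x.2, x.1 + 29/9 * x.2)

def ecoef : ℕ → ℕ → ℚ × ℚ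
  | 0, _ => (1, 0)
  | k+1, m =>
    let a := ecoef k m
    let b := mulr (ecoef k (m+1))
    ((29/10 * (k+1+m) * a.1 + 9/5 * (k-m) * b.1) / (481/100 * (k+1)),
     (29/10 * (k+1+m) * a.2 + 9/5 * (k-m) * b.2) / (481/100 * (k+1)))

def fcoef (k b : ℕ) : ℚ × ℚ :=
  let a := ecoef k (b+1)
  let z := mulr (ecoef k (b+2))
  mulr (((b+1) * a.1 - 9/10 * (b+2) * z.1) / (2 * (k+1)),
        ((b+1) * a.2 - 9/10 * (b+2) * z.2) / (2 * (k+1)))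

def gcoef (n b : ℕ) : ℚ × ℚ :=
  ((n+1) * (-(9/20)) + ∑ k ∈ Finset.range n, ((n:ℚ) - k) * (fcoef k b).1,
   (n+1) * (371/200) + ∑ k ∈ Finset.range n, ((n:ℚ) - k) * (fcoef k b).2)

noncomputable def val (r : ℝ) (x : ℚ × ℚ) : ℝ := (x.1 : ℝ) + (x.2 : ℝ) * r

lemma val_mulr {r : ℝ} (hr : 9/10 * r^2 - 29/10 * r + 1 = 0) (x : ℚ × ℚ) :
    val r (mulr x) = r * val r x := by
  simp only [val, mulr]
  push_cast
  linear_combination (-(10/9) * (x.2:ℝ)) * hr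

lemma hb29 : 2 * √(9/10:ℝ) < 29/10 := by linarith [s_lt]

lemma geo29 {r : ℝ} (hr : 9/10 * r^2 - 29/10 * r + 1 = 0) (h0 : 0 < r) (h1 : r < 1) (m : ℕ) :
    CC √(9/10) (29/10) 1 m = CC √(9/10) (29/10) 1 0 * (√(9/10) * r) ^ m ∧
    CC √(9/10) (29/10) 1 0 * (29/10 - 9/5 * r) = 2 := by
  have hp := s_pos
  have hs := s_sq
  have hu1 : √(9/10) * r < 1 := by nlinarith [s_lt]
  have hq : √(9/10) * (√(9/10) * r)^2 - 29/10 * (√(9/10) * r) + √(9/10) = 0 := by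
    linear_combination √(9/10) * hr + √(9/10) * r^2 * hs
  refine ⟨geo s_pos hb29 (by positivity) hu1 hq m, ?_⟩
  have := C10 s_pos hb29 (by positivity) hu1 hq
  linear_combination this + 2 * CC √(9/10) (29/10) 1 0 * r * hs

lemma Eform {r : ℝ} (hr : 9/10 * r^2 - 29/10 * r + 1 = 0) (h0 : 0 < r) (h1 : r < 1) (k : ℕ) :
    ∀ m : ℕ, CC √(9/10) (29/10) (k+1) m =
      CC √(9/10) (29/10) 1 0 * (√(9/10) * r) ^ m * val r (ecoef k m) := by
  induction k with
  | zero =>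
    intro m
    rw [zero_add, (geo29 hr h0 h1 m).1]
    simp [val, ecoef]
  | succ k ih =>
    intro m
    have h := step s_pos hb29 k m
    rw [ih m, ih (m+1)] at h
    have hv : val r (ecoef (k+1) m) * (481/100 * (k+1)) =
        29/10 * (k+1+m) * val r (ecoef k m) + 9/5 * (k-m) * (r * val r (ecoef k (m+1))) := by
      rw [← val_mulr hr]
      simp only [val, ecoef]
      push_cast
      field_simp
      ring
    have hs := s_sq
    have hk : ((k:ℝ)+1) ≠ 0 := by positivity
    have hk2 : (481/100 * ((k:ℝ)+1)) ≠ 0 := by positivity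
    apply mul_right_cancel₀ hk2
    rw [mul_assoc _ _ (481/100 * ((k:ℝ)+1)), hv]
    rw [pow_succ (√(9/10) * r) m] at h
    rw [hs] at h
    generalize CC √(9/10) (29/10) 1 0 = E at *
    generalize (√(9/10) * r)^m = X at *
    generalize CC √(9/10) (29/10) (k+1+1) m = Y at *
    generalize val r (ecoef k m) = A at *
    generalize val r (ecoef k (m+1)) = B at *
    linear_combination h + 2 * (k-m) * E * X * r * B * hs

lemma T291 {r : ℝ} (hr : 9/10 * r^2 - 29/10 * r + 1 = 0) (h0 : 0 < r) (h1 : r < 1) (b : ℕ) :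
    TT √(9/10) (29/10) 1 (b+1) = √(9/10)^b * (CC √(9/10) (29/10) 1 0 * r^b *
      (-(9/20) + 371/200 * r)) := by
  have h2 := SSC s_pos hb29 1 b
  have h3 := SSC s_pos hb29 1 (b+1)
  rw [(geo29 hr h0 h1 b).1, (geo29 hr h0 h1 (b+2)).1] at h2
  rw [(geo29 hr h0 h1 (b+1)).1, (geo29 hr h0 h1 (b+1+2)).1] at h3
  unfold TT
  have hs := s_sq
  generalize CC √(9/10) (29/10) 1 0 = E at *
  generalize √(9/10:ℝ) = s at *
  simp only [mul_pow, pow_add] at h2 h3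
  have e3 : s^4 = (9/10)^2 := by rw [← hs]; ring
  linear_combination (1/2) * h2 - (s/2) * h3 + E * s^b * r^b * (-(r^2/2) * hs - (r/2) * hs + (r^3/2) * e3)
    + E * s^b * r^b * (-(1/2) + 9/20 * r + 29/20) * hr

lemma T29k {r : ℝ} (hr : 9/10 * r^2 - 29/10 * r + 1 = 0) (h0 : 0 < r) (h1 : r < 1) (k b : ℕ) :
    TT √(9/10) (29/10) (k+2) (b+1) = √(9/10)^b * (CC √(9/10) (29/10) 1 0 * r^b *
      val r (fcoef k b)) := by
  have h2 := IBP s_pos hb29 k (b+1)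
  have h3 := IBP s_pos hb29 k (b+2)
  rw [Eform hr h0 h1] at h2 h3
  have hv : val r (fcoef k b) * (2 * (k+1)) =
      r * ((b+1) * val r (ecoef k (b+1)) - 9/10 * (b+2) * (r * val r (ecoef k (b+2)))) := by
    rw [← val_mulr hr (ecoef k (b+2))]
    unfold fcoef
    rw [val_mulr hr]
    simp only [val]
    push_cast
    field_simp
    ring
  unfold TT
  have hs := s_sq
  have hp := s_pos
  generalize CC √(9/10) (29/10) 1 0 = E at *
  generalize √(9/10:ℝ) = s at *
  have hk : s * (2 * ((k:ℝ)+1)) ≠ 0 := by positivity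
  apply mul_right_cancel₀ hk
  simp only [mul_pow, pow_add] at h2 h3
  push_cast at h2 h3
  simp only [add_assoc, Nat.reduceAdd] at *
  generalize val r (ecoef k (b+1)) = A at *
  generalize val r (ecoef k (b+2)) = B at *
  linear_combination h2 - s * h3 - s^b * E * r^b * s * hv - (b+2) * E * s^b * s * r^b * r^2 * B * hs

lemma Gform {r : ℝ} (hr : 9/10 * r^2 - 29/10 * r + 1 = 0) (h0 : 0 < r) (h1 : r < 1) (n b : ℕ) :
    ∫ t in Ioi (0:ℝ), erl 10 (n+1) t * EL 9 10 (b+1) t =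
      9 + (b - 8) - (n+1)/10 + CC √(9/10) (29/10) 1 0 * r^b * val r (gcoef n b) := by
  rw [fub, mul_right_comm, JT, T191, T192, Finset.sum_range_succ', T291 hr h0 h1]
  have e : ∀ k ∈ Finset.range n, (((n+1:ℕ):ℝ) - ((k+1:ℕ):ℝ)) *
      TT √(9/10) (29/10) (k+1+1) (b+1) = √(9/10)^b * (CC √(9/10) (29/10) 1 0 * r^b) *
        (((n:ℝ)-k) * (((fcoef k b).1:ℝ) + ((fcoef k b).2:ℝ) * r)) := by
    intro k _
    rw [T29k hr h0 h1]
    simp only [val]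
    push_cast
    ring
  rw [Finset.sum_congr rfl e, ← Finset.mul_sum]
  have hg : val r (gcoef n b) = (n+1) * (-(9/20) + 371/200 * r) +
      ∑ k ∈ Finset.range n, (((n:ℝ)-k) * (((fcoef k b).1:ℝ) + ((fcoef k b).2:ℝ) * r)) := by
    simp only [val, gcoef]
    push_cast
    simp only [mul_add, Finset.sum_add_distrib, add_mul, Finset.sum_mul]
    simp only [mul_assoc]
    ring
  rw [hg]
  have hp := pref b
  generalize ∑ k ∈ Finset.range n, (((n:ℝ)-k) * (((fcoef k b).1:ℝ) + ((fcoef k b).2:ℝ) * r)) = S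
  generalize CC √(9/10) (29/10) 1 0 = E
  push_cast at hp ⊢
  linear_combination ((b:ℝ) - 8 - (n+1)/10 + E * r^b * S + (n+1) * E * r^b * (-(9/20) + 371/200 * r)) * hp

lemma num1 : -(8501/100) ≤ (mulr (gcoef 8 8)).1 - (gcoef 9 7).1 := by
  norm_num [gcoef, fcoef, ecoef, mulr, Finset.sum_range_succ]
lemma num2 : (3004/100) ≤ (mulr (gcoef 8 8)).2 - (gcoef 9 7).2 := by
  norm_num [gcoef, fcoef, ecoef, mulr, Finset.sum_range_succ]

/-- For λ = 9, μ = 10: joining the longer queue (9) first beats joining the shorter (8) first. -/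
theorem ETT_longer_first_9_8 : ETT 9 10 9 8 < ETT 9 10 8 9 := by
  obtain ⟨r, hr, hl, hu⟩ : ∃ r : ℝ, 9/10 * r^2 - 29/10 * r + 1 = 0 ∧ 3926/10000 < r ∧
      r < 3927/10000 := by
    have h := Real.sq_sqrt (show (0:ℝ) ≤ 481/100 by norm_num)
    have hn := Real.sqrt_nonneg (481/100:ℝ)
    refine ⟨(29/10 - √(481/100)) / (9/5), ?_, ?_, ?_⟩
    · linear_combination (5/18) * h
    · nlinarith
    · nlinarith
  have h0 : 0 < r := by linarith
  have h1 : r < 1 := by linarith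
  have G1 := Gform hr h0 h1 9 7
  have G2 := Gform hr h0 h1 8 8
  have hE := (geo29 hr h0 h1 0).2
  have hm := val_mulr hr (gcoef 8 8)
  unfold ETT
  generalize CC √(9/10) (29/10) 1 0 = E at *
  norm_num at G1 G2 ⊢
  rw [G1, G2]
  have n1 : (-(8501/100) : ℝ) ≤ (mulr (gcoef 8 8)).1 - (gcoef 9 7).1 := by
    have h := (Rat.cast_le (K := ℝ)).2 num1
    push_cast at h
    exact h
  have n2 : ((3004/100) : ℝ) ≤ (mulr (gcoef 8 8)).2 - (gcoef 9 7).2 := by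
    have h := (Rat.cast_le (K := ℝ)).2 num2
    push_cast at h
    exact h
  have hE0 : 0 < E := by
    by_contra hneg
    nlinarith
  have hE1 : E ≤ 912/1000 := by nlinarith
  have hV : -(7322/100) ≤ val r (mulr (gcoef 8 8)) - val r (gcoef 9 7) := by
    simp only [val]
    nlinarith
  have hr7 : r^7 ≤ (3927/10000)^7 := pow_le_pow_left₀ h0.le hu.le 7
  have hEr : E * r^7 ≤ 912/1000 * (3927/10000)^7 := by gcongr
  have hEr0 : 0 < E * r^7 := by positivity
  have key : -(1/10) < E * r^7 * (val r (mulr (gcoef 8 8)) - val r (gcoef 9 7)) := by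
    have := mul_le_mul_of_nonneg_left hV hEr0.le
    norm_num at hEr
    nlinarith
  rw [hm] at key
  have k2 : E * r^8 * val r (gcoef 8 8) - E * r^7 * val r (gcoef 9 7) > -(1/10) := by
    linear_combination key
  linarith
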